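/- For every integer n ≥ 1, the following identity holds in ℤ[p,q,t,u,v,w]: Σ_{σ∈S_n} p^{res σ} q^{les σ} t^{des σ} u^{da* σ} v^{dd* σ} w^{valley* σ} = Σ_{σ∈S_n} p^{nest* σ} q^{cros* σ} t^{drop* σ − 1} u^{cda* σ + fix* σ} v^{cdd* σ} w^{cvalley* σ}. (Note that drop* σ ≥ 1 for every σ∈S_n, since σ*(n) < n.) -/

import Mathlib

open scoped Classical
open Finset

noncomputable section

namespace SZpaper

/-- `σ` as a 1-indexed function on `[1,n]`, extended by `0` elsewhere
(boundary convention `σ(0)=σ(n+1)=0`). -/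
def pext (n : ℕ) (σ : Equiv.Perm (Fin n)) (i : ℕ) : ℕ :=
  if h : 1 ≤ i ∧ i ≤ n then ((σ ⟨i - 1, by omega⟩ : Fin n) : ℕ) + 1 else 0

/-- `σ` extended with the Brändén boundary convention `σ(0)=σ(n+1)=n+1`. -/
def pextB (n : ℕ) (σ : Equiv.Perm (Fin n)) (i : ℕ) : ℕ :=
  if h : 1 ≤ i ∧ i ≤ n then ((σ ⟨i - 1, by omega⟩ : Fin n) : ℕ) + 1 else n + 1

/-- `σ` extended with the boundary convention `σ(0)=0`, `σ(n+1)=n+1`. -/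
def pextC (n : ℕ) (σ : Equiv.Perm (Fin n)) (i : ℕ) : ℕ :=
  if h : 1 ≤ i ∧ i ≤ n then ((σ ⟨i - 1, by omega⟩ : Fin n) : ℕ) + 1
  else if i = 0 then 0 else n + 1

/-- The set of pairs `(i,j)` with `i, j ∈ [1,n]`. -/
def pairs (n : ℕ) : Finset (ℕ × ℕ) := Finset.Icc 1 n ×ˢ Finset.Icc 1 n

/-- `des σ = #{i ∈ [n−1] : σ(i) > σ(i+1)}`. -/
def desStat (n : ℕ) (σ : Equiv.Perm (Fin n)) : ℕ :=
  ((Finset.Icc 1 (n - 1)).filter fun i => pext n σ (i + 1) < pext n σ i).card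

/-- `les σ = #{(i,j) : 2 ≤ i < j ≤ n, σ(i−1) > σ(j) > σ(i)}`. -/
def lesStat (n : ℕ) (σ : Equiv.Perm (Fin n)) : ℕ :=
  ((pairs n).filter fun x => 2 ≤ x.1 ∧ x.1 < x.2 ∧
    pext n σ x.1 < pext n σ x.2 ∧ pext n σ x.2 < pext n σ (x.1 - 1)).card

/-- `less σ = #{(i,j) : 2 ≤ i < j ≤ n, σ(i−1) < σ(j) < σ(i)}`. -/
def lessStat (n : ℕ) (σ : Equiv.Perm (Fin n)) : ℕ :=
  ((pairs n).filter fun x => 2 ≤ x.1 ∧ x.1 < x.2 ∧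
    pext n σ (x.1 - 1) < pext n σ x.2 ∧ pext n σ x.2 < pext n σ x.1).card

/-- `res σ = #{(i,j) : 1 ≤ i < j ≤ n−1, σ(j+1) > σ(i) > σ(j)}`. -/
def resStat (n : ℕ) (σ : Equiv.Perm (Fin n)) : ℕ :=
  ((pairs n).filter fun x => x.1 < x.2 ∧ x.2 ≤ n - 1 ∧
    pext n σ x.2 < pext n σ x.1 ∧ pext n σ x.1 < pext n σ (x.2 + 1)).card

/-- `ress σ = #{(i,j) : 1 ≤ i < j ≤ n−1, σ(j+1) < σ(i) < σ(j)}`. -/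
def ressStat (n : ℕ) (σ : Equiv.Perm (Fin n)) : ℕ :=
  ((pairs n).filter fun x => x.1 < x.2 ∧ x.2 ≤ n - 1 ∧
    pext n σ (x.2 + 1) < pext n σ x.1 ∧ pext n σ x.1 < pext n σ x.2).card

/-! Linear statistics with the boundary convention `σ(0)=σ(n+1)=0` (starred). -/

def peakStar (n : ℕ) (σ : Equiv.Perm (Fin n)) : ℕ :=
  ((Finset.Icc 1 n).filter fun i =>
    pext n σ (i - 1) < pext n σ i ∧ pext n σ (i + 1) < pext n σ i).card

def valleyStar (n : ℕ) (σ : Equiv.Perm (Fin n)) : ℕ :=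
  ((Finset.Icc 1 n).filter fun i =>
    pext n σ i < pext n σ (i - 1) ∧ pext n σ i < pext n σ (i + 1)).card

def daStar (n : ℕ) (σ : Equiv.Perm (Fin n)) : ℕ :=
  ((Finset.Icc 1 n).filter fun i =>
    pext n σ (i - 1) < pext n σ i ∧ pext n σ i < pext n σ (i + 1)).card

def ddStar (n : ℕ) (σ : Equiv.Perm (Fin n)) : ℕ :=
  ((Finset.Icc 1 n).filter fun i =>
    pext n σ (i + 1) < pext n σ i ∧ pext n σ i < pext n σ (i - 1)).card

/-! Linear statistics with the Brändén boundary convention `σ(0)=σ(n+1)=n+1`. -/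

def peakB (n : ℕ) (σ : Equiv.Perm (Fin n)) : ℕ :=
  ((Finset.Icc 1 n).filter fun i =>
    pextB n σ (i - 1) < pextB n σ i ∧ pextB n σ (i + 1) < pextB n σ i).card

def valleyB (n : ℕ) (σ : Equiv.Perm (Fin n)) : ℕ :=
  ((Finset.Icc 1 n).filter fun i =>
    pextB n σ i < pextB n σ (i - 1) ∧ pextB n σ i < pextB n σ (i + 1)).card

def daB (n : ℕ) (σ : Equiv.Perm (Fin n)) : ℕ :=
  ((Finset.Icc 1 n).filter fun i =>
    pextB n σ (i - 1) < pextB n σ i ∧ pextB n σ i < pextB n σ (i + 1)).card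

def ddB (n : ℕ) (σ : Equiv.Perm (Fin n)) : ℕ :=
  ((Finset.Icc 1 n).filter fun i =>
    pextB n σ (i + 1) < pextB n σ i ∧ pextB n σ i < pextB n σ (i - 1)).card

/-! Linear statistics with the boundary convention `σ(0)=0`, `σ(n+1)=n+1`. -/

def valleyC (n : ℕ) (σ : Equiv.Perm (Fin n)) : ℕ :=
  ((Finset.Icc 1 n).filter fun i =>
    pextC n σ i < pextC n σ (i - 1) ∧ pextC n σ i < pextC n σ (i + 1)).card

def daC (n : ℕ) (σ : Equiv.Perm (Fin n)) : ℕ :=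
  ((Finset.Icc 1 n).filter fun i =>
    pextC n σ (i - 1) < pextC n σ i ∧ pextC n σ i < pextC n σ (i + 1)).card

def ddC (n : ℕ) (σ : Equiv.Perm (Fin n)) : ℕ :=
  ((Finset.Icc 1 n).filter fun i =>
    pextC n σ (i + 1) < pextC n σ i ∧ pextC n σ i < pextC n σ (i - 1)).card

/-- `fmax σ`: the number of double ascents (convention `σ(0)=0`, `σ(n+1)=n+1`)
which are left-to-right maxima. -/
def fmaxStat (n : ℕ) (σ : Equiv.Perm (Fin n)) : ℕ :=
  ((Finset.Icc 1 n).filter fun i =>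
    pextC n σ (i - 1) < pextC n σ i ∧ pextC n σ i < pextC n σ (i + 1) ∧
    ∀ j ∈ Finset.Ico 1 i, pext n σ j < pext n σ i).card

/-! Cyclic statistics. -/

def excStat (n : ℕ) (σ : Equiv.Perm (Fin n)) : ℕ :=
  ((Finset.Icc 1 n).filter fun i => i < pext n σ i).card

def wexStat (n : ℕ) (σ : Equiv.Perm (Fin n)) : ℕ :=
  ((Finset.Icc 1 n).filter fun i => i ≤ pext n σ i).card

def dropStat (n : ℕ) (σ : Equiv.Perm (Fin n)) : ℕ :=
  ((Finset.Icc 1 n).filter fun i => pext n σ i < i).card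

def fixStat (n : ℕ) (σ : Equiv.Perm (Fin n)) : ℕ :=
  ((Finset.Icc 1 n).filter fun i => pext n σ i = i).card

/-- cyclic valleys: `x` with `σ⁻¹(x) > x < σ(x)`. -/
def cvalleyStat (n : ℕ) (σ : Equiv.Perm (Fin n)) : ℕ :=
  ((Finset.Icc 1 n).filter fun x => x < pext n σ⁻¹ x ∧ x < pext n σ x).card

/-- double excedances: `x` with `σ⁻¹(x) < x < σ(x)`. -/
def cdaStat (n : ℕ) (σ : Equiv.Perm (Fin n)) : ℕ :=
  ((Finset.Icc 1 n).filter fun x => pext n σ⁻¹ x < x ∧ x < pext n σ x).card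

/-- double drops: `x` with `σ⁻¹(x) > x > σ(x)`. -/
def cddStat (n : ℕ) (σ : Equiv.Perm (Fin n)) : ℕ :=
  ((Finset.Icc 1 n).filter fun x => x < pext n σ⁻¹ x ∧ pext n σ x < x).card

/-- crossings. -/
def crosStat (n : ℕ) (σ : Equiv.Perm (Fin n)) : ℕ :=
  ((pairs n).filter fun x =>
    (x.1 < x.2 ∧ x.2 ≤ pext n σ x.1 ∧ pext n σ x.1 < pext n σ x.2) ∨
    (x.2 < x.1 ∧ pext n σ x.1 < x.2 ∧ pext n σ x.2 < pext n σ x.1)).card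

/-- nestings. -/
def nestStat (n : ℕ) (σ : Equiv.Perm (Fin n)) : ℕ :=
  ((pairs n).filter fun x =>
    (x.1 < x.2 ∧ x.2 ≤ pext n σ x.2 ∧ pext n σ x.2 < pext n σ x.1) ∨
    (x.2 < x.1 ∧ pext n σ x.2 < x.2 ∧ pext n σ x.1 < pext n σ x.2)).card

/-- number of cycles of `σ` (fixed points count as cycles). -/
def cycStat (n : ℕ) (σ : Equiv.Perm (Fin n)) : ℕ :=
  Multiset.card σ.cycleType + (Finset.univ.filter fun x => σ x = x).card

/-! Star statistics: `σ*(i) = σ(i) − 1`, a bijection `[n] → {0,…,n−1}`;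
we extend `σ*` by `0` outside `[1,n]`. -/

def starf (n : ℕ) (σ : Equiv.Perm (Fin n)) (i : ℕ) : ℕ :=
  if 1 ≤ i ∧ i ≤ n then pext n σ i - 1 else 0

/-- `(σ*)⁻¹(i) = σ⁻¹(i+1)`, defined for `0 ≤ i ≤ n−1`. -/
def invstarf (n : ℕ) (σ : Equiv.Perm (Fin n)) (i : ℕ) : ℕ :=
  pext n σ⁻¹ (i + 1)

def dropStarStat (n : ℕ) (σ : Equiv.Perm (Fin n)) : ℕ :=
  ((Finset.Icc 1 n).filter fun i => starf n σ i < i).card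

def fixStarStat (n : ℕ) (σ : Equiv.Perm (Fin n)) : ℕ :=
  ((Finset.Icc 1 n).filter fun i => starf n σ i = i).card

def wexStarStat (n : ℕ) (σ : Equiv.Perm (Fin n)) : ℕ :=
  ((Finset.Icc 1 n).filter fun i => i ≤ starf n σ i).card

def cdaStarStat (n : ℕ) (σ : Equiv.Perm (Fin n)) : ℕ :=
  ((Finset.Icc 1 n).filter fun i => invstarf n σ i < i ∧ i < starf n σ i).card

def cddStarStat (n : ℕ) (σ : Equiv.Perm (Fin n)) : ℕ :=
  ((Finset.Icc 1 n).filter fun i => i < invstarf n σ i ∧ starf n σ i < i).card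

def cvalleyStarStat (n : ℕ) (σ : Equiv.Perm (Fin n)) : ℕ :=
  ((Finset.Icc 1 n).filter fun i => i < invstarf n σ i ∧ i < starf n σ i).card

def crosStarStat (n : ℕ) (σ : Equiv.Perm (Fin n)) : ℕ :=
  ((pairs n).filter fun x =>
    (x.1 < x.2 ∧ x.2 ≤ starf n σ x.1 ∧ starf n σ x.1 < starf n σ x.2) ∨
    (x.2 < x.1 ∧ starf n σ x.1 < x.2 ∧ starf n σ x.2 < starf n σ x.1)).card

def nestStarStat (n : ℕ) (σ : Equiv.Perm (Fin n)) : ℕ :=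
  ((pairs n).filter fun x =>
    (x.1 < x.2 ∧ x.2 ≤ starf n σ x.2 ∧ starf n σ x.2 < starf n σ x.1) ∨
    (x.2 < x.1 ∧ starf n σ x.2 < x.2 ∧ starf n σ x.1 < starf n σ x.2)).card

/-- `cyc* σ`: the number of cycles of the functional digraph of `σ*` on `[n]`,
counted as the number of `i ∈ [1,n]` that lie on a cycle of `σ*` and are
minimal in their cycle. (The component of `σ*` that is a path from `n` to `0`
contributes no such `i`.) -/
def cycStarStat (n : ℕ) (σ : Equiv.Perm (Fin n)) : ℕ :=
  ((Finset.Icc 1 n).filter fun i =>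
    (∃ m ∈ Finset.Icc 1 n, (starf n σ)^[m] i = i) ∧
    ∀ m ∈ Finset.range (n + 1), i ≤ (starf n σ)^[m] i).card

/-! Motzkin paths, encoded as step sequences `γ : Fin m → Fin 3`
(`0` = up step `(1,1)`, `1` = level step `(1,0)`, `2` = down step `(1,−1)`). -/

/-- The height (ordinate) of the path after `i` steps. -/
def hgt (m : ℕ) (γ : Fin m → Fin 3) (i : ℕ) : ℤ :=
  ∑ j ∈ Finset.range i, if hj : j < m then 1 - ((γ ⟨j, hj⟩ : ℕ) : ℤ) else 0

/-- A step sequence is a Motzkin path if it never goes below the x-axis and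
ends at height `0`. -/
def IsMotzkin (m : ℕ) (γ : Fin m → Fin 3) : Prop :=
  (∀ i ≤ m, 0 ≤ hgt m γ i) ∧ hgt m γ m = 0

/-- The (finite) set of Motzkin paths of length `m`. -/
def motzkin (m : ℕ) : Finset (Fin m → Fin 3) :=
  Finset.univ.filter fun γ => IsMotzkin m γ

/-- number of up (North-East) steps. -/
def neCount (m : ℕ) (γ : Fin m → Fin 3) : ℕ :=
  (Finset.univ.filter fun i => γ i = 0).card

/-- number of level (East) steps. -/
def eCount (m : ℕ) (γ : Fin m → Fin 3) : ℕ :=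
  (Finset.univ.filter fun i => γ i = 1).card

/-- the `(p,q)`-integer `[m]_{p,q} = p^{m−1} + p^{m−2}q + ⋯ + q^{m−1}`. -/
def pqInt {R : Type*} [CommRing R] (p q : R) (m : ℕ) : R :=
  ∑ j ∈ Finset.range m, p ^ (m - 1 - j) * q ^ j

/-! ### Histories -/

/-- Letters `(a, b, c)` of a history: two type bits and a choice. -/
abbrev Letter : Type := Bool × Bool × ℕ

/-- The histories of length `m` starting at height `h` and ending at height `0`: a letter
`(a, b, c)` read at height `h` needs `c < h`, and changes the height by `[¬ b] - [a]`. -/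
def histories : ℕ → ℕ → Finset (List Letter)
  | 0, h => if h = 0 then {[]} else ∅
  | m + 1, h => (Finset.univ ×ˢ Finset.univ ×ˢ Finset.range h).biUnion fun x =>
      (histories m (h + (!x.2.1).toNat - x.1.toNat)).image (List.cons x)

lemma card_histories_succ_le (m h : ℕ) :
    (histories (m + 1) h).card ≤
      h * ((histories m (h + 1)).card + 2 * (histories m h).card + (histories m (h - 1)).card) := by
  refine Finset.card_biUnion_le.trans ?_
  refine (Finset.sum_le_sum fun x _ => Finset.card_image_le).trans ?_
  rw [Finset.sum_product]
  simp only [Finset.sum_product, Fintype.sum_bool, Finset.sum_const, Finset.card_range,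
    smul_eq_mul, Bool.not_true, Bool.not_false, Bool.toNat_true, Bool.toNat_false]
  simp only [add_zero, Nat.sub_zero, Nat.add_sub_cancel]
  apply le_of_eq
  ring

lemma card_histories_zero_right (m : ℕ) : (histories (m + 1) 0).card = 0 := by
  simpa using card_histories_succ_le m 0

lemma card_histories_le (m h : ℕ) :
    (histories (m + 1) (h + 1)).card ≤ (m + 1).factorial * m.choose h := by
  induction m generalizing h with
  | zero =>
    refine (card_histories_succ_le 0 (h + 1)).trans ?_
    rcases h with _ | h <;> simp [histories]
  | succ m ih =>
    refine (card_histories_succ_le (m + 1) (h + 1)).trans ?_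
    have h1 := ih (h + 1)
    have h2 := ih h
    have h3 : (histories (m + 1) h).card * (h + 1) ≤
        (m + 1).factorial * ((m + 2).choose (h + 1) - 2 * m.choose h - m.choose (h + 1)) *
          (h + 1) := by
      refine Nat.mul_le_mul_right _ ?_
      rcases h with _ | h
      · simp [card_histories_zero_right]
      · refine (ih h).trans (Nat.mul_le_mul_left _ ?_)
        simp only [Nat.choose_succ_succ' (m + 1), Nat.choose_succ_succ' m]
        omega
    have h4 : 2 * m.choose h + m.choose (h + 1) ≤ (m + 2).choose (h + 1) := by
      rcases h with _ | h <;>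
      · simp only [Nat.choose_succ_succ' (m + 1), Nat.choose_succ_succ' m]
        try simp
        try omega
    have h5 : (m + 1 + 1) * (m + 1).choose h = (m + 2).choose (h + 1) * (h + 1) :=
      Nat.add_one_mul_choose_eq (m + 1) h
    obtain ⟨d, hd⟩ := Nat.exists_eq_add_of_le h4
    rw [hd, Nat.sub_sub, Nat.add_sub_cancel_left] at h3
    rw [hd] at h5
    rw [Nat.add_sub_cancel, Nat.factorial_succ (m + 1)]
    calc _ ≤ (h + 1) * ((m + 1).factorial * m.choose (h + 1) +
          2 * ((m + 1).factorial * m.choose h)) + (histories (m + 1) h).card * (h + 1) := by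
          nlinarith
      _ ≤ (m + 1).factorial * ((2 * m.choose h + m.choose (h + 1) + d) * (h + 1)) := by nlinarith
      _ = _ := by rw [← h5]; ring

lemma card_histories_one_le {n : ℕ} (hn : 1 ≤ n) : (histories n 1).card ≤ n.factorial := by
  obtain ⟨m, rfl⟩ := Nat.exists_eq_add_of_le' hn
  simpa using card_histories_le m 0

/-- `(a, b, c)` is a history on `[1, n]` with heights `h`. -/
structure IsHistory (n : ℕ) (a b : ℕ → Bool) (c h : ℕ → ℕ) : Prop where
  start : h 1 = 1
  finish : h (n + 1) = 0
  lt : ∀ k, 1 ≤ k → k ≤ n → c k < h k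
  step : ∀ k, 1 ≤ k → k ≤ n → h (k + 1) + (a k).toNat = h k + (!b k).toNat

/-- The list of letters of `(a, b, c)` on `[1, n]`. -/
def word (n : ℕ) (a b : ℕ → Bool) (c : ℕ → ℕ) : List Letter :=
  (List.range' 1 n).map fun k => (a k, b k, c k)

lemma IsHistory.word_mem {n : ℕ} {a b : ℕ → Bool} {c h : ℕ → ℕ} (H : IsHistory n a b c h) :
    word n a b c ∈ histories n 1 := by
  have key : ∀ m k, 1 ≤ k → k + m = n + 1 →
      (List.range' k m).map (fun k => (a k, b k, c k)) ∈ histories m (h k) := by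
    intro m
    induction m with
    | zero =>
      rintro k - hk
      obtain rfl : k = n + 1 := by omega
      simp [histories, H.finish]
    | succ m ih =>
      intro k hk hkm
      simp only [List.range'_succ, List.map_cons, histories, Finset.mem_biUnion]
      refine ⟨(a k, b k, c k), by simpa using H.lt k hk (by omega), ?_⟩
      refine Finset.mem_image_of_mem _ ?_
      have h1 := H.step k hk (by omega)
      rw [← h1, Nat.add_sub_cancel]
      exact ih (k + 1) (by omega) (by omega)
  have := key n 1 le_rfl (by omega)
  rwa [H.start] at this

lemma word_eq_iff {n : ℕ} {a b a' b' : ℕ → Bool} {c c' : ℕ → ℕ} :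
    word n a b c = word n a' b' c' ↔
      ∀ k, 1 ≤ k → k ≤ n → a k = a' k ∧ b k = b' k ∧ c k = c' k := by
  simp only [word, List.map_inj_left, List.mem_range'_1, Prod.mk.injEq]
  exact forall_congr' fun k => ⟨fun H h1 h2 => H ⟨h1, by omega⟩, fun H h => H h.1 (by omega)⟩

lemma IsHistory.height_eq {n : ℕ} {a b a' b' : ℕ → Bool} {c c' h h' : ℕ → ℕ}
    (H : IsHistory n a b c h) (H' : IsHistory n a' b' c' h')
    (hw : word n a b c = word n a' b' c') : ∀ k, 1 ≤ k → k ≤ n → h k = h' k := by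
  intro k hk
  induction k, hk using Nat.le_induction with
  | base => intro _; rw [H.start, H'.start]
  | succ k hk ih =>
    intro hkn
    have h1 := H.step k hk (by omega)
    have h2 := H'.step k hk (by omega)
    obtain ⟨ha, hb, -⟩ := word_eq_iff.1 hw k hk (by omega)
    rw [← ha, ← hb, ← ih (by omega)] at h2
    omega

/-! ### Values of a permutation -/

section Values

variable {n : ℕ} (σ : Equiv.Perm (Fin n))

@[simp] lemma pext_zero : pext n σ 0 = 0 := by simp [pext]

lemma pext_of_lt {i : ℕ} (h : n < i) : pext n σ i = 0 := by
  rw [pext, dif_neg (by omega)]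

lemma pext_le (i : ℕ) : pext n σ i ≤ n := by
  unfold pext
  split_ifs <;> omega

lemma pext_pos {i : ℕ} (h : 1 ≤ i) (h' : i ≤ n) : 1 ≤ pext n σ i := by
  rw [pext, dif_pos ⟨h, h'⟩]
  omega

lemma pext_inv_pext {i : ℕ} (h : i ≤ n) : pext n σ⁻¹ (pext n σ i) = i := by
  rcases Nat.eq_zero_or_pos i with rfl | hi
  · simp
  · have h1 : pext n σ i = (σ ⟨i - 1, by omega⟩ : Fin n) + 1 := by rw [pext, dif_pos ⟨hi, h⟩]
    rw [pext, dif_pos ⟨pext_pos σ hi h, pext_le σ i⟩]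
    simp only [h1, Nat.add_sub_cancel, Fin.eta, Equiv.Perm.inv_def, Equiv.symm_apply_apply]
    omega

lemma pext_pext_inv {i : ℕ} (h : i ≤ n) : pext n σ (pext n σ⁻¹ i) = i := by
  simpa using pext_inv_pext σ⁻¹ h

lemma pext_inj {i j : ℕ} (hi : i ≤ n) (hj : j ≤ n) (h : pext n σ i = pext n σ j) : i = j := by
  rw [← pext_inv_pext σ hi, h, pext_inv_pext σ hj]

lemma pext_injective {τ : Equiv.Perm (Fin n)}
    (h : ∀ i, 1 ≤ i → i ≤ n → pext n σ i = pext n τ i) : σ = τ := by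
  ext i
  have := h (i + 1) (by omega) (by omega)
  simpa [pext, Nat.succ_le_iff] using this

lemma sum_pext_inv (F : ℕ → ℕ) :
    ∑ i ∈ Finset.Icc 1 n, F i = ∑ k ∈ Finset.Icc 1 n, F (pext n σ⁻¹ k) := by
  refine Finset.sum_nbij' (pext n σ) (pext n σ⁻¹) ?_ ?_ ?_ ?_ ?_ <;> intro i hi <;>
    rw [Finset.mem_Icc] at hi
  · exact Finset.mem_Icc.2 ⟨pext_pos σ hi.1 hi.2, pext_le σ i⟩
  · exact Finset.mem_Icc.2 ⟨pext_pos σ⁻¹ hi.1 hi.2, pext_le σ⁻¹ i⟩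
  · exact pext_inv_pext σ hi.2
  · exact pext_pext_inv σ hi.2
  · rw [pext_inv_pext σ hi.2]

lemma card_filter_pext_inv (P : ℕ → Prop) [DecidablePred P] :
    ((Finset.Icc 1 n).filter P).card =
      ((Finset.Icc 1 n).filter fun k => P (pext n σ⁻¹ k)).card := by
  simpa only [Finset.card_filter] using sum_pext_inv σ fun i => if P i then 1 else 0

end Values

lemma card_filter_pairs (n : ℕ) (P : ℕ × ℕ → Prop) [DecidablePred P] :
    ((pairs n).filter P).card =
      ∑ k ∈ Finset.Icc 1 n, ((Finset.Icc 1 n).filter fun i => P (i, k)).card := by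
  simp only [Finset.card_filter, pairs]
  rw [Finset.sum_product_right]

/-! ### The linear history of a permutation -/

section Linear

variable {n : ℕ} (σ : Equiv.Perm (Fin n))

/-- The value before `k` in `0 σ(1) … σ(n) 0` is smaller than `k`. -/
def linA (k : ℕ) : Bool := decide (pext n σ (pext n σ⁻¹ k - 1) < k)

/-- The value after `k` in `0 σ(1) … σ(n) 0` is smaller than `k`. -/
def linB (k : ℕ) : Bool := decide (pext n σ (pext n σ⁻¹ k + 1) < k)

/-- The number of ascents straddling `k` on its right. -/
def linRes (k : ℕ) : ℕ :=
  ((Finset.Icc 1 n).filter fun j =>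
    pext n σ⁻¹ k < j ∧ pext n σ j < k ∧ k < pext n σ (j + 1)).card

/-- The number of descents straddling `k` on its left. -/
def linLes (k : ℕ) : ℕ :=
  ((Finset.Icc 1 n).filter fun i =>
    i < pext n σ⁻¹ k ∧ pext n σ i < k ∧ k < pext n σ (i - 1)).card

/-- The number of maximal runs of values `≥ k` in `σ`. -/
def linHeight (k : ℕ) : ℕ :=
  ((Finset.range (n + 1)).filter fun i => pext n σ i < k ∧ k ≤ pext n σ (i + 1)).card

lemma pext_succ_ne (hn : 1 ≤ n) {i : ℕ} (hi : i ≤ n) : pext n σ (i + 1) ≠ pext n σ i := by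
  intro h
  rcases Nat.lt_or_ge i n with h' | h'
  · have := pext_inj σ (i := i + 1) (by omega) hi h
    omega
  · obtain rfl : i = n := by omega
    rw [pext_of_lt σ (Nat.lt_succ_self _)] at h
    have := pext_pos σ hn le_rfl
    omega

lemma pext_pred_ne {i : ℕ} (hi : 1 ≤ i) (hi' : i ≤ n) : pext n σ (i - 1) ≠ pext n σ i := by
  intro h
  have := pext_inj σ (i := i - 1) (by omega) hi' h
  omega

lemma card_ups_eq (P : ℕ → Prop) (p : ℕ) :
    ((Finset.range p).filter fun i => ¬ P i ∧ P (i + 1)).card + (if P 0 then 1 else 0) =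
      ((Finset.range p).filter fun i => P i ∧ ¬ P (i + 1)).card + (if P p then 1 else 0) := by
  induction p with
  | zero => simp
  | succ p ih =>
    simp only [Finset.card_filter, Finset.sum_range_succ] at ih ⊢
    by_cases h1 : P p <;> by_cases h2 : P (p + 1) <;> simp [h1, h2] at ih ⊢ <;> omega

lemma linHeight_eq {k : ℕ} (hk : 1 ≤ k) (hkn : k ≤ n) :
    linHeight σ k = linRes σ k + linLes σ k + 1 := by
  have hp := pext_pos σ⁻¹ hk hkn
  have hp' := pext_le σ⁻¹ k
  have hkp := pext_pext_inv σ hkn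
  unfold linHeight linRes linLes
  set p := pext n σ⁻¹ k with hpdef
  have h1 := card_ups_eq (fun i => k ≤ pext n σ i) p
  simp only [pext_zero, not_le, hkp, le_refl, if_true] at h1
  rw [if_neg (by omega), add_zero] at h1
  have h2 : ((Finset.Icc 1 n).filter fun i =>
      i < p ∧ pext n σ i < k ∧ k < pext n σ (i - 1)).card =
      ((Finset.range p).filter fun i => k ≤ pext n σ i ∧ pext n σ (i + 1) < k).card := by
    symm
    refine Finset.card_nbij' (· + 1) (· - 1) ?_ ?_ ?_ ?_
    · intro i hi
      simp only [Finset.coe_filter, Finset.mem_range, Set.mem_ofPred_eq, Finset.mem_Icc,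
        Nat.add_sub_cancel] at hi ⊢
      have h3 : i + 1 ≠ p := by rintro h; rw [h] at hi; omega
      have h4 : pext n σ i ≠ k := by
        intro h
        have := pext_inj σ (i := i) (by omega) hp' (h.trans hkp.symm)
        omega
      omega
    · intro i hi
      simp only [Finset.coe_filter, Finset.mem_range, Set.mem_ofPred_eq, Finset.mem_Icc] at hi ⊢
      rw [Nat.sub_add_cancel hi.1.1]
      omega
    · intro i _
      simp
    · intro i hi
      simp only [Finset.coe_filter, Set.mem_ofPred_eq, Finset.mem_Icc] at hi
      exact Nat.sub_add_cancel hi.1.1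
  rw [h2, add_assoc, ← h1, ← Finset.card_union_of_disjoint]
  · congr 1
    ext i
    simp only [Finset.mem_filter, Finset.mem_range, Finset.mem_union, Finset.mem_Icc]
    constructor
    · rintro ⟨h3, h4, h5⟩
      have h6 : i ≠ p := by rintro rfl; omega
      by_cases h7 : i < p
      · exact Or.inr ⟨h7, h4, h5⟩
      · have h8 : pext n σ (i + 1) ≠ k := by
          intro h
          have h9 : i + 1 ≤ n := by
            by_contra h9
            rw [pext_of_lt σ (by omega)] at h
            omega
          have := pext_inj σ h9 hp' (h.trans hkp.symm)
          omega
        exact Or.inl ⟨by omega, by omega, h4, by omega⟩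
    · rintro (h | h) <;> omega
  · rw [Finset.disjoint_left]
    intro i hi hi'
    simp only [Finset.mem_filter, Finset.mem_range] at hi hi'
    omega

lemma linHeight_succ {k : ℕ} (hk : 1 ≤ k) (hkn : k ≤ n) :
    linHeight σ (k + 1) + (linA σ k).toNat = linHeight σ k + (!linB σ k).toNat := by
  have hp := pext_pos σ⁻¹ hk hkn
  have hp' := pext_le σ⁻¹ k
  have hkp := pext_pext_inv σ hkn
  unfold linHeight linA linB
  set p := pext n σ⁻¹ k with hpdef
  have hA : (decide (pext n σ (p - 1) < k)).toNat =
      ∑ i ∈ Finset.range (n + 1), if i = p - 1 then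
        (decide (pext n σ (p - 1) < k)).toNat else 0 := by
    rw [Finset.sum_ite_eq' , if_pos (by simp; omega)]
  have hB : (!decide (pext n σ (p + 1) < k)).toNat =
      ∑ i ∈ Finset.range (n + 1), if i = p then
        (!decide (pext n σ (p + 1) < k)).toNat else 0 := by
    rw [Finset.sum_ite_eq', if_pos (by simp; omega)]
  rw [hA, hB, Finset.card_filter, Finset.card_filter, ← Finset.sum_add_distrib,
    ← Finset.sum_add_distrib]
  refine Finset.sum_congr rfl fun i hi => ?_
  rw [Finset.mem_range] at hi
  by_cases h1 : i = p
  · subst h1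
    have h2 := pext_succ_ne σ (by omega) hp'
    have h3 : p ≠ p - 1 := by omega
    rcases Nat.lt_or_gt_of_ne (hkp ▸ h2) with h4 | h4
    · simp [hkp, h3, h4, h4.le]
    · have h5 : k ≤ pext n σ (p + 1) := by omega
      simp [hkp, h3, Nat.succ_le_of_lt h4, h5.not_gt]
  · have h4 : pext n σ i ≠ k := fun h =>
      h1 (pext_inj σ (i := i) (by omega) hp' (h.trans hkp.symm))
    by_cases h5 : i = p - 1
    · have h6 : i + 1 = p := by omega
      by_cases h7 : pext n σ (p - 1) < k <;> simp [h5, hp, h7, hkp] <;> omega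
    · have h6 : pext n σ (i + 1) ≠ k := by
        intro h
        have h9 : i + 1 ≤ n := by
          by_contra h9
          rw [pext_of_lt σ (by omega)] at h
          omega
        have := pext_inj σ h9 hp' (h.trans hkp.symm)
        omega
      simp only [h1, h5, if_false, add_zero]
      congr 1
      apply propext
      omega

lemma isHistory_lin (hn : 1 ≤ n) :
    IsHistory n (linA σ) (linB σ) (linRes σ) (linHeight σ) where
  start := by
    rw [linHeight, Finset.card_eq_one]
    refine ⟨0, ?_⟩
    ext i
    simp only [Finset.mem_filter, Finset.mem_range, Finset.mem_singleton, Nat.lt_one_iff]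
    constructor
    · rintro ⟨h1, h2, -⟩
      by_contra h
      have := pext_pos σ (i := i) (by omega) (by omega)
      omega
    · rintro rfl
      simpa using pext_pos σ le_rfl hn
  finish := by
    rw [linHeight, Finset.card_eq_zero, Finset.filter_eq_empty_iff]
    intro i _ h
    have := pext_le σ (i + 1)
    omega
  lt k hk hkn := by
    rw [linHeight_eq σ hk hkn]
    omega
  step k hk hkn := linHeight_succ σ hk hkn

/-- The values `a < k` that are followed by a value `≥ k`. -/
def gaps (k : ℕ) : Finset ℕ :=
  (Finset.range k).filter fun a => k ≤ pext n σ (pext n σ⁻¹ a + 1)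

lemma linRes_eq_card_gaps {k : ℕ} (hk : 1 ≤ k) (hkn : k ≤ n) :
    linRes σ k = ((gaps σ k).filter fun a => pext n σ⁻¹ k < pext n σ⁻¹ a).card := by
  have hp' := pext_le σ⁻¹ k
  have hkp := pext_pext_inv σ hkn
  refine Finset.card_nbij' (pext n σ) (pext n σ⁻¹) ?_ ?_ ?_ ?_
  · intro j hj
    simp only [gaps, Finset.coe_filter, Finset.mem_filter, Finset.mem_range, Set.mem_ofPred_eq,
      Finset.mem_Icc] at hj ⊢
    rw [pext_inv_pext σ hj.1.2]
    omega
  · intro a ha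
    simp only [gaps, Finset.coe_filter, Finset.mem_filter, Finset.mem_range, Set.mem_ofPred_eq,
      Finset.mem_Icc] at ha ⊢
    rw [pext_pext_inv σ (by omega)]
    have := pext_le σ⁻¹ a
    have h6 : pext n σ (pext n σ⁻¹ a + 1) ≠ k := by
      intro h
      have h9 : pext n σ⁻¹ a + 1 ≤ n := by
        by_contra h9
        rw [pext_of_lt σ (by omega)] at h
        omega
      have := pext_inj σ h9 hp' (h.trans hkp.symm)
      omega
    omega
  · intro j hj
    simp only [Finset.coe_filter, Set.mem_ofPred_eq, Finset.mem_Icc] at hj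
    exact pext_inv_pext σ hj.1.2
  · intro a ha
    simp only [gaps, Finset.coe_filter, Finset.mem_filter, Finset.mem_range,
      Set.mem_ofPred_eq] at ha
    exact pext_pext_inv σ (by omega)

lemma inv_lt_inv_iff_exists_gap {k a : ℕ} (hkn : k ≤ n) (ha : a < k) :
    pext n σ⁻¹ a < pext n σ⁻¹ k ↔
      ∃ l ∈ gaps σ k, ¬ pext n σ⁻¹ k < pext n σ⁻¹ l ∧ ¬ pext n σ⁻¹ l < pext n σ⁻¹ a := by
  have hp' := pext_le σ⁻¹ k
  have hkp := pext_pext_inv σ hkn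
  constructor
  · intro h
    obtain ⟨i, hi, hmax⟩ := Finset.exists_max_image
      ((Finset.range (pext n σ⁻¹ k)).filter fun i => pext n σ i < k) id
      ⟨pext n σ⁻¹ a, by simp [h, pext_pext_inv σ (ha.le.trans hkn), ha]⟩
    simp only [Finset.mem_filter, Finset.mem_range, id] at hi hmax
    refine ⟨pext n σ i, ?_, ?_, ?_⟩
    · simp only [gaps, Finset.mem_filter, Finset.mem_range]
      rw [pext_inv_pext σ (by omega)]
      refine ⟨hi.2, ?_⟩
      by_contra hlt
      rcases Nat.lt_or_ge (i + 1) (pext n σ⁻¹ k) with h1 | h1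
      · have := hmax (i + 1) ⟨h1, by omega⟩
        omega
      · rw [show i + 1 = pext n σ⁻¹ k by omega] at hlt
        omega
    · rw [pext_inv_pext σ (by omega)]
      omega
    · rw [pext_inv_pext σ (by omega)]
      have := hmax (pext n σ⁻¹ a) ⟨h, by rwa [pext_pext_inv σ (by omega)]⟩
      omega
  · rintro ⟨l, hl, h1, h2⟩
    simp only [gaps, Finset.mem_filter, Finset.mem_range] at hl
    have : pext n σ⁻¹ l ≠ pext n σ⁻¹ k := fun h => by
      have := pext_inj σ⁻¹ (by omega) hkn h
      omega
    omega

lemma pext_succ_inv_eq_iff {k a : ℕ} (hk : 1 ≤ k) (hkn : k ≤ n) (ha : a < k) :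
    pext n σ (pext n σ⁻¹ a + 1) = k ↔
      linA σ k = true ∧ pext n σ⁻¹ a < pext n σ⁻¹ k ∧
        ∀ b < k, ¬ (pext n σ⁻¹ a < pext n σ⁻¹ b ∧ pext n σ⁻¹ b < pext n σ⁻¹ k) := by
  have hp := pext_pos σ⁻¹ hk hkn
  have hp' := pext_le σ⁻¹ k
  have hkp := pext_pext_inv σ hkn
  rw [linA, decide_eq_true_iff]
  constructor
  · intro h
    have h9 : pext n σ⁻¹ a + 1 ≤ n := by
      by_contra h9
      rw [pext_of_lt σ (by omega)] at h
      omega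
    have h1 := pext_inj σ h9 hp' (h.trans hkp.symm)
    refine ⟨?_, by omega, fun b _ => by omega⟩
    rw [← h1, Nat.add_sub_cancel, pext_pext_inv σ (by omega)]
    exact ha
  · rintro ⟨h1, h2, h3⟩
    have h4 := h3 _ h1
    rw [pext_inv_pext σ (by omega)] at h4
    rw [show pext n σ⁻¹ a + 1 = pext n σ⁻¹ k by omega, hkp]

variable {σ} {τ : Equiv.Perm (Fin n)}

lemma filter_right_eq {S : Finset ℕ} {f g : ℕ → ℕ} {x : ℕ}
    (hfg : ∀ a ∈ S, ∀ b ∈ S, f a < f b ↔ g a < g b)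
    (hc : (S.filter fun a => f x < f a).card = (S.filter fun a => g x < g a).card) :
    (S.filter fun a => f x < f a) = S.filter fun a => g x < g a := by
  by_cases h : (S.filter fun a => f x < f a) ⊆ S.filter fun a => g x < g a
  · exact Finset.eq_of_subset_of_card_le h hc.ge
  · obtain ⟨y, hy, hy'⟩ := Finset.not_subset.1 h
    simp only [Finset.mem_filter, not_and, not_lt] at hy hy'
    refine (Finset.eq_of_subset_of_card_le (fun z hz => ?_) hc.le).symm
    simp only [Finset.mem_filter] at hz ⊢
    have h1 := hy' hy.1
    have h2 := (hfg y hy.1 z hz.1).2 (by omega)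
    exact ⟨hz.1, by omega⟩

lemma linear_pattern_eq (hn : 1 ≤ n)
    (hw : word n (linA σ) (linB σ) (linRes σ) = word n (linA τ) (linB τ) (linRes τ)) :
    ∀ k, 1 ≤ k → k ≤ n + 1 →
      (∀ a < k, ∀ b < k, pext n σ⁻¹ a < pext n σ⁻¹ b ↔ pext n τ⁻¹ a < pext n τ⁻¹ b) ∧
      (∀ a < k, k ≤ pext n σ (pext n σ⁻¹ a + 1) ↔ k ≤ pext n τ (pext n τ⁻¹ a + 1)) := by
  intro k hk
  induction k, hk using Nat.le_induction with
  | base =>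
    intro _
    refine ⟨fun a ha b hb => ?_, fun a ha => ?_⟩
    · obtain rfl : a = 0 := by omega
      obtain rfl : b = 0 := by omega
      simp
    · obtain rfl : a = 0 := by omega
      simp [pext_pos σ le_rfl hn, pext_pos τ le_rfl hn]
  | succ k hk ih =>
    intro hkn'
    have hkn : k ≤ n := by omega
    obtain ⟨ho, hg⟩ := ih (by omega)
    obtain ⟨hA, hB, hc⟩ := word_eq_iff.1 hw k hk hkn
    have hgaps : gaps σ k = gaps τ k :=
      Finset.filter_congr fun a ha => hg a (Finset.mem_range.1 ha)
    have hlt : ∀ a ∈ gaps τ k, a < k := fun a ha => by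
      simp only [gaps, Finset.mem_filter, Finset.mem_range] at ha
      exact ha.1
    rw [linRes_eq_card_gaps σ hk hkn, linRes_eq_card_gaps τ hk hkn, hgaps] at hc
    have hfilter := filter_right_eq (fun a ha b hb => ho a (hlt a ha) b (hlt b hb)) hc
    have hright : ∀ a ∈ gaps τ k,
        (pext n σ⁻¹ k < pext n σ⁻¹ a ↔ pext n τ⁻¹ k < pext n τ⁻¹ a) := fun a ha => by
      have := Finset.ext_iff.1 hfilter a
      simpa [ha] using this
    have hleft : ∀ a < k, (pext n σ⁻¹ a < pext n σ⁻¹ k ↔ pext n τ⁻¹ a < pext n τ⁻¹ k) := by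
      intro a ha
      rw [inv_lt_inv_iff_exists_gap σ hkn ha, inv_lt_inv_iff_exists_gap τ hkn ha, hgaps]
      refine exists_congr fun l => and_congr_right fun hl => ?_
      rw [hright l hl, ho l (hlt l hl) a ha]
    have hne : ∀ ρ : Equiv.Perm (Fin n), ∀ a < k, pext n ρ⁻¹ a ≠ pext n ρ⁻¹ k := by
      intro ρ a ha h
      have := pext_inj ρ⁻¹ (by omega) hkn h
      omega
    refine ⟨fun a ha b hb => ?_, fun a ha => ?_⟩
    · rcases Nat.lt_succ_iff_lt_or_eq.1 ha with ha | rfl <;>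
        rcases Nat.lt_succ_iff_lt_or_eq.1 hb with hb | rfl
      · exact ho a ha b hb
      · exact hleft a ha
      · have h1 := hleft b hb
        have h2 := hne σ b hb
        have h3 := hne τ b hb
        omega
      · simp
    · rcases Nat.lt_succ_iff_lt_or_eq.1 ha with ha | rfl
      · have h1 : pext n σ (pext n σ⁻¹ a + 1) = k ↔ pext n τ (pext n τ⁻¹ a + 1) = k := by
          rw [pext_succ_inv_eq_iff σ hk hkn ha, pext_succ_inv_eq_iff τ hk hkn ha, hA, hleft a ha]
          refine and_congr_right fun _ => and_congr_right fun _ => forall₂_congr fun b hb => ?_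
          rw [ho a ha b hb, hleft b hb]
        have h2 := hg a ha
        omega
      · have h1 := pext_succ_ne σ hn (pext_le σ⁻¹ a)
        have h2 := pext_succ_ne τ hn (pext_le τ⁻¹ a)
        rw [pext_pext_inv _ hkn] at h1 h2
        rw [linB, linB, decide_eq_decide] at hB
        omega

lemma card_filter_inv_lt (σ : Equiv.Perm (Fin n)) {a : ℕ} :
    ((Finset.range (n + 1)).filter fun b => pext n σ⁻¹ b < pext n σ⁻¹ a).card =
      pext n σ⁻¹ a := by
  have hle := pext_le σ⁻¹ a
  conv_rhs => rw [← Finset.card_range (pext n σ⁻¹ a)]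
  refine Finset.card_nbij' (pext n σ⁻¹) (pext n σ) ?_ ?_ ?_ ?_ <;> intro b hb <;>
    simp only [Finset.coe_filter, Finset.coe_range, Set.mem_ofPred_eq, Set.mem_Iio,
      Finset.mem_range] at hb ⊢
  · exact hb.2
  · have := pext_le σ b
    rw [pext_inv_pext σ (by omega)]
    omega
  · exact pext_pext_inv σ (by omega)
  · exact pext_inv_pext σ (by omega)

lemma lin_injective (hn : 1 ≤ n)
    (hw : word n (linA σ) (linB σ) (linRes σ) = word n (linA τ) (linB τ) (linRes τ)) :
    σ = τ := by
  obtain ⟨ho, -⟩ := linear_pattern_eq hn hw (n + 1) (by omega) le_rfl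
  rw [← inv_inj]
  refine pext_injective _ fun a _ han => ?_
  rw [← card_filter_inv_lt σ, ← card_filter_inv_lt τ]
  refine congrArg Finset.card (Finset.filter_congr fun b hb => ?_)
  exact ho b (Finset.mem_range.1 hb) a (by omega)

end Linear

/-! ### The cyclic history of a permutation -/

section Cyclic

lemma eqOn_of_inversion_card {α β : Type*} [LinearOrder α] [LinearOrder β] {f g : α → β}
    (S : Finset α) (hf : Set.InjOn f S) (hg : Set.InjOn g S) (himg : S.image f = S.image g)
    (hc : ∀ j ∈ S, (S.filter fun i => i < j ∧ f j < f i).card =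
      (S.filter fun i => i < j ∧ g j < g i).card) : ∀ j ∈ S, f j = g j := by
  induction S using Finset.induction_on_max with
  | empty => simp
  | insert m S hm ih =>
    have hmS : m ∉ S := fun h => lt_irrefl m (hm m h)
    have hcard : ∀ φ : α → β, Set.InjOn φ (insert m S : Finset α) →
        ((insert m S).filter fun i => i < m ∧ φ m < φ i).card =
          (((insert m S).image φ).filter fun y => φ m < y).card := by
      intro φ hφ
      rw [Finset.filter_image, Finset.card_image_of_injOn]
      · congr 1
        refine Finset.filter_congr fun i hi => and_iff_right_of_imp fun h => ?_
        rcases Finset.mem_insert.1 hi with rfl | hi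
        · exact absurd h (lt_irrefl _)
        · exact hm i hi
      · exact hφ.mono (Finset.coe_subset.2 (Finset.filter_subset _ _))
    have htop : f m = g m := by
      have h1 := hc m (Finset.mem_insert_self m S)
      rw [hcard f hf, hcard g hg, himg] at h1
      have hfm : f m ∈ (insert m S).image g := by
        rw [← himg]
        exact Finset.mem_image_of_mem f (Finset.mem_insert_self m S)
      have hgm : g m ∈ (insert m S).image g :=
        Finset.mem_image_of_mem g (Finset.mem_insert_self m S)
      have aux : ∀ (T : Finset β) (x y : β), y ∈ T → x < y →
          (T.filter fun z => y < z).card < (T.filter fun z => x < z).card := by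
        intro T x y hy hxy
        refine Finset.card_lt_card ((Finset.ssubset_iff_of_subset fun z hz => ?_).2 ⟨y, ?_, ?_⟩)
        · rw [Finset.mem_filter] at hz ⊢
          exact ⟨hz.1, hxy.trans hz.2⟩
        · simp [hy, hxy]
        · simp
      rcases lt_trichotomy (f m) (g m) with h | h | h
      · exact absurd h1 (aux _ _ _ hgm h).ne'
      · exact h
      · exact absurd h1 (aux _ _ _ hfm h).ne
    have hsub : (S : Set α) ⊆ (insert m S : Finset α) :=
      Finset.coe_subset.2 (Finset.subset_insert m S)
    have herase : ∀ φ : α → β, Set.InjOn φ (insert m S : Finset α) →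
        S.image φ = ((insert m S).image φ).erase (φ m) := by
      intro φ hφ
      rw [Finset.image_insert, Finset.erase_insert]
      intro h
      obtain ⟨i, hi, him⟩ := Finset.mem_image.1 h
      have := hφ (Finset.mem_coe.2 (Finset.mem_insert_of_mem hi))
        (Finset.mem_coe.2 (Finset.mem_insert_self m S)) him
      exact hmS (this ▸ hi)
    intro j hj
    rcases Finset.mem_insert.1 hj with rfl | hj
    · exact htop
    · refine ih (hf.mono hsub) (hg.mono hsub) ?_ (fun j hj => ?_) j hj
      · rw [herase f hf, herase g hg, himg, htop]
      · have h1 := hc j (Finset.mem_insert_of_mem hj)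
        have h2 := hm j hj
        rwa [Finset.filter_insert, Finset.filter_insert, if_neg (fun h => h2.not_gt h.1),
          if_neg (fun h => h2.not_gt h.1)] at h1

lemma eqOn_of_inversion_card' {α β : Type*} [LinearOrder α] [LinearOrder β] {f g : α → β}
    (S : Finset α) (hf : Set.InjOn f S) (hg : Set.InjOn g S) (himg : S.image f = S.image g)
    (hc : ∀ j ∈ S, (S.filter fun i => j < i ∧ f i < f j).card =
      (S.filter fun i => j < i ∧ g i < g j).card) : ∀ j ∈ S, f j = g j := by
  exact eqOn_of_inversion_card (α := αᵒᵈ) (β := βᵒᵈ) S hf hg himg hc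

variable {n : ℕ} (σ : Equiv.Perm (Fin n))

/-- The preimage of `k` under `σ*` is at most `k`. -/
def cycA (k : ℕ) : Bool := decide (invstarf n σ k ≤ k)

/-- `k` is a drop of `σ*`. -/
def cycB (k : ℕ) : Bool := decide (starf n σ k < k)

/-- The number of nestings of `σ*` with second entry `k`. -/
def cycNest (k : ℕ) : ℕ :=
  ((Finset.Icc 1 n).filter fun i =>
    (i < k ∧ k ≤ starf n σ k ∧ starf n σ k < starf n σ i) ∨
    (k < i ∧ starf n σ k < k ∧ starf n σ i < starf n σ k)).card

/-- The number of crossings of `σ*` with second entry `k`. -/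
def cycCros (k : ℕ) : ℕ :=
  ((Finset.Icc 1 n).filter fun i =>
    (i < k ∧ k ≤ starf n σ i ∧ starf n σ i < starf n σ k) ∨
    (k < i ∧ starf n σ i < k ∧ starf n σ k < starf n σ i)).card

/-- The number of drops of `σ*` from `[k, n]` to below `k`. -/
def cycHeight (k : ℕ) : ℕ :=
  ((Finset.Icc 1 n).filter fun i => k ≤ i ∧ starf n σ i < k).card

lemma starf_add_one {i : ℕ} (hi : 1 ≤ i) (hin : i ≤ n) : starf n σ i + 1 = pext n σ i := by
  rw [starf, if_pos ⟨hi, hin⟩]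
  exact Nat.sub_add_cancel (pext_pos σ hi hin)

lemma starf_inj {i j : ℕ} (hi : 1 ≤ i) (hin : i ≤ n) (hj : 1 ≤ j) (hjn : j ≤ n)
    (h : starf n σ i = starf n σ j) : i = j :=
  pext_inj σ hin hjn (by rw [← starf_add_one σ hi hin, ← starf_add_one σ hj hjn, h])

lemma starf_lt {i : ℕ} (hi : 1 ≤ i) (hin : i ≤ n) : starf n σ i < n := by
  have h1 := starf_add_one σ hi hin
  have h2 := pext_le σ i
  omega

lemma invstarf_starf {i : ℕ} (hi : 1 ≤ i) (hin : i ≤ n) : invstarf n σ (starf n σ i) = i := by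
  rw [invstarf, starf_add_one σ hi hin, pext_inv_pext σ hin]

lemma invstarf_pos {k : ℕ} (hk : k < n) : 1 ≤ invstarf n σ k :=
  pext_pos σ⁻¹ (Nat.succ_le_succ (Nat.zero_le k)) hk

lemma invstarf_le (k : ℕ) : invstarf n σ k ≤ n := pext_le σ⁻¹ (k + 1)

lemma starf_invstarf {k : ℕ} (hk : k < n) : starf n σ (invstarf n σ k) = k := by
  have h := starf_add_one σ (invstarf_pos σ hk) (invstarf_le σ k)
  rw [invstarf, pext_pext_inv σ hk] at h
  exact Nat.succ.inj h

lemma invstarf_self : invstarf n σ n = 0 := pext_of_lt σ⁻¹ (Nat.lt_succ_self n)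

lemma cycHeight_eq {k : ℕ} (hk : 1 ≤ k) (hkn : k ≤ n) :
    cycHeight σ k = cycNest σ k + cycCros σ k + 1 := by
  have hsplit : cycNest σ k + cycCros σ k = ((Finset.Icc 1 n).filter fun i =>
      if starf n σ k < k then k < i ∧ starf n σ i < k else i < k ∧ k ≤ starf n σ i).card := by
    rw [cycNest, cycCros, ← Finset.card_union_of_disjoint]
    · congr 1
      ext i
      simp only [Finset.mem_union, Finset.mem_filter, Finset.mem_Icc]
      rw [← and_or_left]
      refine and_congr_right fun hi => ?_
      have hne : i ≠ k → starf n σ i ≠ starf n σ k :=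
        fun h h' => h (starf_inj σ hi.1 hi.2 hk hkn h')
      split_ifs <;> omega
    · rw [Finset.disjoint_left]
      intro i hi hi'
      simp only [Finset.mem_filter] at hi hi'
      omega
  rw [hsplit, cycHeight]
  split_ifs with hd
  · rw [← Finset.card_insert_of_notMem (a := k) (by simp)]
    congr 1
    ext i
    simp only [Finset.mem_insert, Finset.mem_filter, Finset.mem_Icc]
    constructor
    · rintro h
      omega
    · rintro (rfl | h) <;> omega
  · have h1 : ((Finset.Icc 1 n).filter fun i => starf n σ i < k).card = k := by
      conv_rhs => rw [← Finset.card_range k]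
      refine Finset.card_nbij' (starf n σ) (invstarf n σ) ?_ ?_ ?_ ?_ <;> intro i hi <;>
        simp only [Finset.coe_filter, Finset.coe_range, Set.mem_ofPred_eq, Set.mem_Iio,
          Finset.mem_Icc] at hi ⊢
      · exact hi.2
      · rw [starf_invstarf σ (by omega)]
        exact ⟨⟨invstarf_pos σ (by omega), invstarf_le σ i⟩, hi⟩
      · exact invstarf_starf σ hi.1.1 hi.1.2
      · exact starf_invstarf σ (by omega)
    have h2 : ((Finset.Icc 1 n).filter fun i => i < k).card = k - 1 := by
      rw [show (Finset.Icc 1 n).filter (fun i => i < k) = Finset.Ico 1 k by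
        ext i; simp only [Finset.mem_filter, Finset.mem_Icc, Finset.mem_Ico]; omega]
      simp
    have h3 : ((Finset.Icc 1 n).filter fun i => starf n σ i < k).card =
        ((Finset.Icc 1 n).filter fun i => k ≤ i ∧ starf n σ i < k).card +
        ((Finset.Icc 1 n).filter fun i => i < k ∧ starf n σ i < k).card := by
      simp only [Finset.card_filter, ← Finset.sum_add_distrib]
      refine Finset.sum_congr rfl fun i _ => ?_
      by_cases h4 : i < k <;> by_cases h5 : starf n σ i < k <;> simp [h4, h5, not_le.2, not_lt.1]
    have h4 : ((Finset.Icc 1 n).filter fun i => i < k).card =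
        ((Finset.Icc 1 n).filter fun i => i < k ∧ k ≤ starf n σ i).card +
        ((Finset.Icc 1 n).filter fun i => i < k ∧ starf n σ i < k).card := by
      simp only [Finset.card_filter, ← Finset.sum_add_distrib]
      refine Finset.sum_congr rfl fun i _ => ?_
      by_cases h4 : i < k <;> by_cases h5 : starf n σ i < k <;> simp [h4, h5, not_le.2, not_lt.1]
    omega

lemma cycHeight_succ {k : ℕ} (hk : 1 ≤ k) (hkn : k ≤ n) :
    cycHeight σ (k + 1) + (cycA σ k).toNat = cycHeight σ k + (!cycB σ k).toNat := by
  have h1 : cycHeight σ k = ((Finset.Icc 1 n).filter fun i => k < i ∧ starf n σ i < k).card +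
      (cycB σ k).toNat := by
    have : (cycB σ k).toNat = ∑ i ∈ Finset.Icc 1 n, if i = k then (cycB σ k).toNat else 0 := by
      rw [Finset.sum_ite_eq', if_pos (Finset.mem_Icc.2 ⟨hk, hkn⟩)]
    rw [this, cycHeight, Finset.card_filter, Finset.card_filter, ← Finset.sum_add_distrib]
    refine Finset.sum_congr rfl fun i _ => ?_
    by_cases hik : i = k
    · subst hik
      by_cases h : starf n σ i < i <;> simp [cycB, h]
    · simp only [hik, if_false, add_zero]
      congr 1
      apply propext
      omega
  have h2 : cycHeight σ (k + 1) =
      ((Finset.Icc 1 n).filter fun i => k < i ∧ starf n σ i < k).card + (!cycA σ k).toNat := by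
    by_cases hA : invstarf n σ k ≤ k
    · simp only [cycA, hA, decide_true, Bool.not_true, Bool.toNat_false, add_zero, cycHeight]
      congr 1
      refine Finset.filter_congr fun i hi => ?_
      rw [Finset.mem_Icc] at hi
      have : k < i → starf n σ i ≠ k := by
        rintro h rfl
        rw [invstarf_starf σ hi.1 hi.2] at hA
        omega
      omega
    · have hlt : k < n := by
        rcases hkn.lt_or_eq with h | rfl
        · exact h
        · rw [invstarf_self] at hA
          omega
      simp only [cycA, hA, decide_false, Bool.not_false, Bool.toNat_true, cycHeight]
      rw [← Finset.card_insert_of_notMem (a := invstarf n σ k)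
        (by simp [starf_invstarf σ hlt])]
      congr 1
      ext i
      simp only [Finset.mem_insert, Finset.mem_filter, Finset.mem_Icc]
      constructor
      · rintro ⟨hi, hki, hs⟩
        by_cases h : starf n σ i = k
        · exact Or.inl (by rw [← h, invstarf_starf σ hi.1 hi.2])
        · exact Or.inr ⟨hi, hki, by omega⟩
      · rintro (rfl | h)
        · refine ⟨⟨invstarf_pos σ hlt, invstarf_le σ k⟩, by omega, ?_⟩
          rw [starf_invstarf σ hlt]
          omega
        · omega
  rw [h1, h2]
  cases cycA σ k <;> cases cycB σ k <;> simp

lemma isHistory_cyc (hn : 1 ≤ n) :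
    IsHistory n (cycA σ) (cycB σ) (cycNest σ) (cycHeight σ) where
  start := by
    rw [cycHeight, Finset.card_eq_one]
    refine ⟨invstarf n σ 0, ?_⟩
    ext i
    simp only [Finset.mem_filter, Finset.mem_Icc, Finset.mem_singleton, Nat.lt_one_iff]
    constructor
    · rintro ⟨h1, -, h2⟩
      rw [← h2, invstarf_starf σ h1.1 h1.2]
    · rintro rfl
      have := invstarf_pos σ (k := 0) (by omega)
      exact ⟨⟨this, invstarf_le σ 0⟩, this, starf_invstarf σ (by omega)⟩
  finish := by
    rw [cycHeight, Finset.card_eq_zero, Finset.filter_eq_empty_iff]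
    intro i hi h
    rw [Finset.mem_Icc] at hi
    omega
  lt k hk hkn := by
    rw [cycHeight_eq σ hk hkn]
    omega
  step k hk hkn := cycHeight_succ σ hk hkn

lemma image_excedances : ((Finset.Icc 1 n).filter fun k => ¬ cycB σ k).image (starf n σ) =
    (Finset.Ico 1 n).filter fun k => cycA σ k := by
  ext j
  simp only [cycA, cycB, Finset.mem_image, Finset.mem_filter, Finset.mem_Icc, Finset.mem_Ico,
    decide_eq_true_eq, not_lt]
  constructor
  · rintro ⟨i, ⟨hi, h⟩, rfl⟩
    rw [invstarf_starf σ hi.1 hi.2]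
    exact ⟨⟨by omega, starf_lt σ hi.1 hi.2⟩, h⟩
  · rintro ⟨hj, h⟩
    refine ⟨invstarf n σ j, ⟨⟨invstarf_pos σ hj.2, invstarf_le σ j⟩, ?_⟩, starf_invstarf σ hj.2⟩
    rwa [starf_invstarf σ hj.2]

lemma image_drops : ((Finset.Icc 1 n).filter fun k => cycB σ k).image (starf n σ) =
    (Finset.range n).filter fun k => k = 0 ∨ ¬ cycA σ k := by
  ext j
  simp only [cycA, cycB, Finset.mem_image, Finset.mem_filter, Finset.mem_Icc, Finset.mem_range,
    decide_eq_true_eq, not_le]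
  constructor
  · rintro ⟨i, ⟨hi, h⟩, rfl⟩
    rw [invstarf_starf σ hi.1 hi.2]
    exact ⟨starf_lt σ hi.1 hi.2, Or.inr h⟩
  · rintro ⟨hj, h⟩
    have := invstarf_pos σ hj
    refine ⟨invstarf n σ j, ⟨⟨this, invstarf_le σ j⟩, ?_⟩, starf_invstarf σ hj⟩
    rw [starf_invstarf σ hj]
    omega

lemma injOn_starf {S : Finset ℕ} (hS : S ⊆ Finset.Icc 1 n) : Set.InjOn (starf n σ) S := by
  intro i hi j hj h
  have hi' := Finset.mem_Icc.1 (hS hi)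
  have hj' := Finset.mem_Icc.1 (hS hj)
  exact starf_inj σ hi'.1 hi'.2 hj'.1 hj'.2 h

lemma cycNest_of_not_drop {k : ℕ} (h : ¬ cycB σ k) :
    cycNest σ k = (((Finset.Icc 1 n).filter fun k => ¬ cycB σ k).filter fun i =>
      i < k ∧ starf n σ k < starf n σ i).card := by
  rw [cycNest, Finset.filter_filter]
  congr 1
  refine Finset.filter_congr fun i _ => ?_
  simp only [cycB, decide_eq_true_eq] at h ⊢
  omega

lemma cycNest_of_drop {k : ℕ} (h : cycB σ k) :
    cycNest σ k = (((Finset.Icc 1 n).filter fun k => cycB σ k).filter fun i =>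
      k < i ∧ starf n σ i < starf n σ k).card := by
  rw [cycNest, Finset.filter_filter]
  congr 1
  refine Finset.filter_congr fun i _ => ?_
  simp only [cycB, decide_eq_true_eq] at h ⊢
  omega

variable {σ} {τ : Equiv.Perm (Fin n)}

lemma cyc_injective
    (hw : word n (cycA σ) (cycB σ) (cycNest σ) = word n (cycA τ) (cycB τ) (cycNest τ)) :
    σ = τ := by
  have hw' := word_eq_iff.1 hw
  have hE : ((Finset.Icc 1 n).filter fun k => ¬ cycB σ k) =
      (Finset.Icc 1 n).filter fun k => ¬ cycB τ k := Finset.filter_congr fun k hk => by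
    rw [Finset.mem_Icc] at hk
    rw [(hw' k hk.1 hk.2).2.1]
  have hD : ((Finset.Icc 1 n).filter fun k => (cycB σ k : Prop)) =
      (Finset.Icc 1 n).filter fun k => cycB τ k := Finset.filter_congr fun k hk => by
    rw [Finset.mem_Icc] at hk
    rw [(hw' k hk.1 hk.2).2.1]
  have h1 := eqOn_of_inversion_card (f := starf n σ) (g := starf n τ)
    ((Finset.Icc 1 n).filter fun k => ¬ cycB σ k) (injOn_starf σ (Finset.filter_subset _ _))
    (injOn_starf τ (Finset.filter_subset _ _))
    (by
      rw [image_excedances, hE, image_excedances]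
      refine Finset.filter_congr fun k hk => ?_
      rw [Finset.mem_Ico] at hk
      rw [(hw' k hk.1 hk.2.le).1])
    (fun j hj => by
      rw [Finset.mem_filter, Finset.mem_Icc] at hj
      obtain ⟨-, hb, hc⟩ := hw' j hj.1.1 hj.1.2
      rw [cycNest_of_not_drop σ hj.2, cycNest_of_not_drop τ (hb ▸ hj.2), ← hE] at hc
      exact hc)
  have h2 := eqOn_of_inversion_card' (f := starf n σ) (g := starf n τ)
    ((Finset.Icc 1 n).filter fun k => (cycB σ k : Prop)) (injOn_starf σ (Finset.filter_subset _ _))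
    (injOn_starf τ (Finset.filter_subset _ _))
    (by
      rw [image_drops, hD, image_drops]
      refine Finset.filter_congr fun k hk => ?_
      rw [Finset.mem_range] at hk
      rcases Nat.eq_zero_or_pos k with rfl | hk'
      · simp
      · rw [(hw' k hk' hk.le).1])
    (fun j hj => by
      rw [Finset.mem_filter, Finset.mem_Icc] at hj
      obtain ⟨-, hb, hc⟩ := hw' j hj.1.1 hj.1.2
      rw [cycNest_of_drop σ hj.2, cycNest_of_drop τ (hb ▸ hj.2), ← hD] at hc
      exact hc)
  refine pext_injective _ fun i hi hin => ?_
  rw [← starf_add_one σ hi hin, ← starf_add_one τ hi hin]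
  by_cases h : cycB σ i
  · rw [h2 i (Finset.mem_filter.2 ⟨Finset.mem_Icc.2 ⟨hi, hin⟩, h⟩)]
  · rw [h1 i (Finset.mem_filter.2 ⟨Finset.mem_Icc.2 ⟨hi, hin⟩, h⟩)]

end Cyclic

/-! ### Statistics in terms of histories -/

section Statistics

variable {n : ℕ} (σ : Equiv.Perm (Fin n))

lemma resStat_eq : resStat n σ = ∑ k ∈ Finset.Icc 1 n, linRes σ k := by
  unfold resStat pairs linRes
  rw [Finset.card_filter, Finset.sum_product, sum_pext_inv σ]
  refine Finset.sum_congr rfl fun k hk => ?_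
  rw [Finset.mem_Icc] at hk
  rw [← Finset.card_filter]
  congr 1
  refine Finset.filter_congr fun j _ => ?_
  dsimp only
  rw [pext_pext_inv σ hk.2]
  have : n < j + 1 → pext n σ (j + 1) = 0 := pext_of_lt σ
  omega

lemma lesStat_eq : lesStat n σ = ∑ k ∈ Finset.Icc 1 n, linLes σ k := by
  unfold lesStat linLes
  rw [card_filter_pairs, sum_pext_inv σ]
  refine Finset.sum_congr rfl fun k hk => ?_
  rw [Finset.mem_Icc] at hk
  congr 1
  refine Finset.filter_congr fun i hi => ?_
  rw [Finset.mem_Icc] at hi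
  dsimp only
  rw [pext_pext_inv σ hk.2]
  by_cases h : i = 1
  · simp [h]
  · omega

lemma desStat_eq (hn : 1 ≤ n) :
    desStat n σ = ((Finset.Icc 1 n).filter fun k => linB σ k).card - 1 := by
  have h : ((Finset.Icc 1 n).filter fun k => linB σ k).card =
      ((Finset.Icc 1 n).filter fun i => pext n σ (i + 1) < pext n σ i).card := by
    rw [card_filter_pext_inv σ fun i => pext n σ (i + 1) < pext n σ i]
    congr 1
    refine Finset.filter_congr fun k hk => ?_
    rw [Finset.mem_Icc] at hk
    rw [pext_pext_inv σ hk.2, linB, decide_eq_true_iff]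
  have h2 : (Finset.Icc 1 n).filter (fun i => pext n σ (i + 1) < pext n σ i) =
      insert n ((Finset.Icc 1 (n - 1)).filter fun i => pext n σ (i + 1) < pext n σ i) := by
    ext i
    simp only [Finset.mem_insert, Finset.mem_filter, Finset.mem_Icc]
    constructor
    · intro h
      omega
    · rintro (rfl | h)
      · refine ⟨⟨hn, le_rfl⟩, ?_⟩
        rw [pext_of_lt σ (Nat.lt_succ_self _)]
        exact pext_pos σ hn le_rfl
      · omega
  rw [h, h2, Finset.card_insert_of_notMem, Nat.add_sub_cancel]
  · rfl
  · simp only [Finset.mem_filter, Finset.mem_Icc]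
    omega

lemma daStar_eq (hn : 1 ≤ n) :
    daStar n σ = ((Finset.Icc 1 n).filter fun k => linA σ k ∧ ¬ linB σ k).card := by
  rw [daStar, card_filter_pext_inv σ]
  congr 1
  refine Finset.filter_congr fun k hk => ?_
  rw [Finset.mem_Icc] at hk
  have := pext_succ_ne σ hn (pext_le σ⁻¹ k)
  rw [pext_pext_inv σ hk.2] at this
  simp only [pext_pext_inv σ hk.2, linA, linB, decide_eq_true_eq]
  omega

lemma ddStar_eq :
    ddStar n σ = ((Finset.Icc 1 n).filter fun k => ¬ linA σ k ∧ linB σ k).card := by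
  rw [ddStar, card_filter_pext_inv σ]
  congr 1
  refine Finset.filter_congr fun k hk => ?_
  rw [Finset.mem_Icc] at hk
  have := pext_pred_ne σ (pext_pos σ⁻¹ hk.1 hk.2) (pext_le σ⁻¹ k)
  rw [pext_pext_inv σ hk.2] at this
  simp only [pext_pext_inv σ hk.2, linA, linB, decide_eq_true_eq]
  omega

lemma valleyStar_eq (hn : 1 ≤ n) :
    valleyStar n σ = ((Finset.Icc 1 n).filter fun k => ¬ linA σ k ∧ ¬ linB σ k).card := by
  rw [valleyStar, card_filter_pext_inv σ]
  congr 1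
  refine Finset.filter_congr fun k hk => ?_
  rw [Finset.mem_Icc] at hk
  have h1 := pext_succ_ne σ hn (pext_le σ⁻¹ k)
  have h2 := pext_pred_ne σ (pext_pos σ⁻¹ hk.1 hk.2) (pext_le σ⁻¹ k)
  rw [pext_pext_inv σ hk.2] at h1 h2
  simp only [pext_pext_inv σ hk.2, linA, linB, decide_eq_true_eq]
  omega

lemma nestStarStat_eq : nestStarStat n σ = ∑ k ∈ Finset.Icc 1 n, cycNest σ k :=
  card_filter_pairs _ _

lemma crosStarStat_eq : crosStarStat n σ = ∑ k ∈ Finset.Icc 1 n, cycCros σ k :=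
  card_filter_pairs _ _

lemma dropStarStat_eq :
    dropStarStat n σ = ((Finset.Icc 1 n).filter fun k => cycB σ k).card := by
  simp [dropStarStat, cycB]

lemma invstarf_eq_self_iff {k : ℕ} (hk : 1 ≤ k) (hkn : k ≤ n) :
    invstarf n σ k = k ↔ starf n σ k = k := by
  constructor <;> intro h
  · have hlt : k < n := by
      rcases hkn.lt_or_eq with h' | rfl
      · exact h'
      · rw [invstarf_self] at h
        omega
    conv_lhs => rw [← h]
    exact starf_invstarf σ hlt
  · conv_lhs => rw [← h]
    exact invstarf_starf σ hk hkn

lemma cdaStarStat_add_fixStarStat_eq : cdaStarStat n σ + fixStarStat n σ =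
    ((Finset.Icc 1 n).filter fun k => cycA σ k ∧ ¬ cycB σ k).card := by
  rw [cdaStarStat, fixStarStat, ← Finset.card_union_of_disjoint, ← Finset.filter_or]
  · congr 1
    refine Finset.filter_congr fun k hk => ?_
    rw [Finset.mem_Icc] at hk
    have := invstarf_eq_self_iff σ hk.1 hk.2
    simp only [cycA, cycB, decide_eq_true_eq]
    omega
  · rw [Finset.disjoint_left]
    intro k hk hk'
    simp only [Finset.mem_filter] at hk hk'
    omega

lemma cddStarStat_eq :
    cddStarStat n σ = ((Finset.Icc 1 n).filter fun k => ¬ cycA σ k ∧ cycB σ k).card := by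
  simp [cddStarStat, cycA, cycB]

lemma cvalleyStarStat_eq :
    cvalleyStarStat n σ = ((Finset.Icc 1 n).filter fun k => ¬ cycA σ k ∧ ¬ cycB σ k).card := by
  rw [cvalleyStarStat]
  congr 1
  refine Finset.filter_congr fun k hk => ?_
  rw [Finset.mem_Icc] at hk
  have := invstarf_eq_self_iff σ hk.1 hk.2
  simp only [cycA, cycB, decide_eq_true_eq]
  omega

end Statistics

lemma image_eq_histories {n : ℕ} (hn : 1 ≤ n) {w : Equiv.Perm (Fin n) → List Letter}
    (hw : Function.Injective w) (hmem : ∀ σ, w σ ∈ histories n 1) :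
    Finset.univ.image w = histories n 1 := by
  refine Finset.eq_of_subset_of_card_le (Finset.image_subset_iff.2 fun σ _ => hmem σ) ?_
  rw [Finset.card_image_of_injective _ hw, Finset.card_univ, Fintype.card_perm, Fintype.card_fin]
  exact card_histories_one_le hn

/-- A permutation of `S_n` carrying linear histories to cyclic ones. -/
lemma exists_perm_word_eq {n : ℕ} (hn : 1 ≤ n) :
    ∃ e : Equiv.Perm (Equiv.Perm (Fin n)), ∀ σ,
      word n (linA σ) (linB σ) (linRes σ) =
        word n (cycA (e σ)) (cycB (e σ)) (cycNest (e σ)) := by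
  have hlin : Function.Injective fun σ : Equiv.Perm (Fin n) =>
      word n (linA σ) (linB σ) (linRes σ) := fun _ _ h => lin_injective hn h
  have hcyc : Function.Injective fun σ : Equiv.Perm (Fin n) =>
      word n (cycA σ) (cycB σ) (cycNest σ) := fun _ _ h => cyc_injective h
  have himg := image_eq_histories hn hcyc fun σ => (isHistory_cyc σ hn).word_mem
  have hex : ∀ σ : Equiv.Perm (Fin n), ∃ τ : Equiv.Perm (Fin n),
      word n (cycA τ) (cycB τ) (cycNest τ) = word n (linA σ) (linB σ) (linRes σ) := fun σ => by
    have h := (isHistory_lin σ hn).word_mem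
    rw [← himg, Finset.mem_image] at h
    obtain ⟨τ, -, hτ⟩ := h
    exact ⟨τ, hτ⟩
  choose e he using hex
  have hinj : Function.Injective e := fun σ τ h => hlin (by
    show word n (linA σ) (linB σ) (linRes σ) = word n (linA τ) (linB τ) (linRes τ)
    rw [← he σ, ← he τ, h])
  exact ⟨Equiv.ofBijective e (Finite.injective_iff_bijective.1 hinj), fun σ => (he σ).symm⟩

open MvPolynomial in
theorem statement14 (n : ℕ) (hn : 1 ≤ n) :
    (∑ σ : Equiv.Perm (Fin n),
        (X 0 : MvPolynomial (Fin 6) ℤ) ^ resStat n σ * X 1 ^ lesStat n σ *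
          X 2 ^ desStat n σ * X 3 ^ daStar n σ * X 4 ^ ddStar n σ *
          X 5 ^ valleyStar n σ) =
    ∑ σ : Equiv.Perm (Fin n),
        (X 0 : MvPolynomial (Fin 6) ℤ) ^ nestStarStat n σ *
          X 1 ^ crosStarStat n σ * X 2 ^ (dropStarStat n σ - 1) *
          X 3 ^ (cdaStarStat n σ + fixStarStat n σ) * X 4 ^ cddStarStat n σ *
          X 5 ^ cvalleyStarStat n σ := by
  obtain ⟨e, he⟩ := exists_perm_word_eq hn
  refine Fintype.sum_equiv e _ _ fun σ => ?_
  have hw := word_eq_iff.1 (he σ)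
  have hh := (isHistory_lin σ hn).height_eq (isHistory_cyc (e σ) hn) (he σ)
  have hcard : ∀ (P : Bool → Bool → Prop) [∀ a b, Decidable (P a b)],
      ((Finset.Icc 1 n).filter fun k => P (linA σ k) (linB σ k)).card =
        ((Finset.Icc 1 n).filter fun k => P (cycA (e σ) k) (cycB (e σ) k)).card := fun P _ => by
    congr 1
    refine Finset.filter_congr fun k hk => ?_
    rw [Finset.mem_Icc] at hk
    rw [(hw k hk.1 hk.2).1, (hw k hk.1 hk.2).2.1]
  have hres : resStat n σ = nestStarStat n (e σ) := by
    rw [resStat_eq, nestStarStat_eq]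
    refine Finset.sum_congr rfl fun k hk => ?_
    rw [Finset.mem_Icc] at hk
    exact (hw k hk.1 hk.2).2.2
  have hles : lesStat n σ = crosStarStat n (e σ) := by
    rw [lesStat_eq, crosStarStat_eq]
    refine Finset.sum_congr rfl fun k hk => ?_
    rw [Finset.mem_Icc] at hk
    have h1 := (hw k hk.1 hk.2).2.2
    have h2 := hh k hk.1 hk.2
    rw [linHeight_eq σ hk.1 hk.2, cycHeight_eq (e σ) hk.1 hk.2] at h2
    omega
  have hdes : desStat n σ = dropStarStat n (e σ) - 1 := by
    rw [desStat_eq σ hn, dropStarStat_eq]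
    exact congrArg (· - 1) (hcard fun _ b => b)
  have hda : daStar n σ = cdaStarStat n (e σ) + fixStarStat n (e σ) := by
    rw [daStar_eq σ hn, cdaStarStat_add_fixStarStat_eq]
    exact hcard fun a b => a ∧ ¬ b
  have hdd : ddStar n σ = cddStarStat n (e σ) := by
    rw [ddStar_eq, cddStarStat_eq]
    exact hcard fun a b => ¬ a ∧ b
  have hvalley : valleyStar n σ = cvalleyStarStat n (e σ) := by
    rw [valleyStar_eq σ hn, cvalleyStarStat_eq]
    exact hcard fun a b => ¬ a ∧ ¬ b
  rw [hres, hles, hdes, hda, hdd, hvalley]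

end SZpaper
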